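/- Every non-trivial graph G has a T-partition of width at most 18·(tw(G)+1)·Δ(G) for some tree T with maximum degree Δ(T) ≤ 6·Δ(G). -/

import Mathlib

open SimpleGraph

/-- The maximum degree of a finite simple graph `G`:
the supremum of the numbers of neighbours of its vertices. -/
noncomputable def maxDeg {V : Type*} [Fintype V] (G : SimpleGraph V) : ℕ :=
  sSup (Set.range fun v => (G.neighborSet v).ncard)

/-- `B` is a `T`-partition of the graph `G`: the tree `T` indexes a partition
`(B x : x ∈ V(T))` of `V(G)` such that for every edge `vw` of `G`, if `v ∈ B x` and
`w ∈ B y` then `x = y` or `xy ∈ E(T)`. -/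
structure IsTreePartition {V ι : Type*} (G : SimpleGraph V) (T : SimpleGraph ι)
    (B : ι → Set V) : Prop where
  /-- `T` is a tree. -/
  isTree : T.IsTree
  /-- the parts are nonempty -/
  part_nonempty : ∀ x, (B x).Nonempty
  /-- every vertex of `G` lies in exactly one part -/
  part_existsUnique : ∀ v, ∃! x, v ∈ B x
  /-- parts containing adjacent vertices are equal or adjacent in `T` -/
  part_adj : ∀ ⦃v w x y⦄, G.Adj v w → v ∈ B x → w ∈ B y → x = y ∨ T.Adj x y

/-- `B` is a tree-decomposition of the graph `G` over the tree `T`: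
every edge of `G` has both ends in a common bag, and for each vertex `v` of `G`
the set of nodes whose bag contains `v` induces a non-empty subtree of `T`. -/
structure IsTreeDecomp {V ι : Type*} (G : SimpleGraph V) (T : SimpleGraph ι)
    (B : ι → Set V) : Prop where
  /-- `T` is a tree. -/
  isTree : T.IsTree
  /-- every edge of `G` lies in some bag -/
  edge_mem : ∀ ⦃u v⦄, G.Adj u v → ∃ x, u ∈ B x ∧ v ∈ B x
  /-- the bags containing a given vertex induce a non-empty subtree -/
  subtree : ∀ v, (T.induce {x | v ∈ B x}).Connected

/-- The treewidth of a finite graph: the minimum, over tree-decompositions,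
of the maximum bag size minus one. -/
noncomputable def treewidth {V : Type} [Fintype V] (G : SimpleGraph V) : ℕ :=
  sInf {k | ∃ (ι : Type) (_ : Fintype ι) (T : SimpleGraph ι) (B : ι → Set V),
    IsTreeDecomp G T B ∧ ∀ x, (B x).ncard ≤ k + 1}

/-- The tree-partition-width of a finite graph: the minimum width of a tree-partition. -/
noncomputable def tpw {V : Type} [Fintype V] (G : SimpleGraph V) : ℕ :=
  sInf {k | ∃ (ι : Type) (_ : Fintype ι) (T : SimpleGraph ι) (B : ι → Set V),
    IsTreePartition G T B ∧ ∀ x, (B x).ncard ≤ k}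

section Separator

variable {V ι : Type*}

/-- Every edge of `T` leaving `D` starts at `x ∈ D`. -/
def LeavesOnlyAt (T : SimpleGraph ι) (x : ι) (D : Finset ι) : Prop :=
  x ∈ D ∧ ∀ d ∈ D, ∀ e ∉ D, T.Adj d e → d = x

lemma mem_bag_of_leavesOnlyAt {T : SimpleGraph ι} {b : ι → Finset V} {x : ι} {D : Finset ι}
    (hD : LeavesOnlyAt T x D) {v : V} (hv : (T.induce {y | v ∈ b y}).Connected)
    {d e : ι} (hd : d ∈ D) (he : e ∉ D) (hvd : v ∈ b d) (hve : v ∈ b e) : v ∈ b x := by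
  obtain ⟨p⟩ := hv.preconnected ⟨d, hvd⟩ ⟨e, hve⟩
  obtain ⟨a, -, h1, h2⟩ := p.exists_boundary_dart {y | y.1 ∈ D} hd he
  have hadj : T.Adj a.fst.1 a.snd.1 := a.adj
  have := hD.2 _ h1 _ h2 hadj
  rw [← this]
  exact a.fst.2

variable [DecidableEq V]

/-- The number of elements of `S` strictly behind the bag `b x` in the nodes `D`,
plus the size of that bag. -/
def behindCard (b : ι → Finset V) (S : Finset V) (x : ι) (D : Finset ι) : ℕ :=
  ((S ∩ D.biUnion b) \ b x).card + (b x).card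

lemma behindCard_le_add {b : ι → Finset V} {S : Finset V} {x : ι} {D D₁ D₂ : Finset ι}
    (h : ∀ d ∈ D, d ∈ D₁ ∨ d ∈ D₂) :
    behindCard b S x D ≤ behindCard b S x D₁ + behindCard b S x D₂ := by
  have hsub : (S ∩ D.biUnion b) \ b x ⊆
      ((S ∩ D₁.biUnion b) \ b x) ∪ ((S ∩ D₂.biUnion b) \ b x) := by
    intro v hv
    simp only [Finset.mem_sdiff, Finset.mem_inter, Finset.mem_biUnion, Finset.mem_union] at hv ⊢
    obtain ⟨⟨hS, d, hd, hvd⟩, hx⟩ := hv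
    rcases h d hd with h' | h'
    · exact Or.inl ⟨⟨hS, d, h', hvd⟩, hx⟩
    · exact Or.inr ⟨⟨hS, d, h', hvd⟩, hx⟩
  have h1 := Finset.card_le_card hsub
  have h2 := Finset.card_union_le ((S ∩ D₁.biUnion b) \ b x) ((S ∩ D₂.biUnion b) \ b x)
  unfold behindCard
  omega

lemma behindCard_le_erase [DecidableEq ι] {b : ι → Finset V} {S : Finset V} {x y : ι}
    {D : Finset ι} :
    behindCard b S x D ≤ behindCard b S y (D.erase x) + (b x).card := by
  have hsub : (S ∩ D.biUnion b) \ b x ⊆ ((S ∩ (D.erase x).biUnion b) \ b y) ∪ b y := by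
    intro v hv
    simp only [Finset.mem_sdiff, Finset.mem_inter, Finset.mem_biUnion, Finset.mem_union,
      Finset.mem_erase] at hv ⊢
    obtain ⟨⟨hS, d, hd, hvd⟩, hx⟩ := hv
    by_cases hy : v ∈ b y
    · exact Or.inr hy
    · refine Or.inl ⟨⟨hS, d, ⟨?_, hd⟩, hvd⟩, hy⟩
      rintro rfl
      exact hx hvd
  have h1 := Finset.card_le_card hsub
  have h2 := Finset.card_union_le ((S ∩ (D.erase x).biUnion b) \ b y) (b y)
  unfold behindCard
  omega

lemma LeavesOnlyAt.exists_split [DecidableEq ι] {T : SimpleGraph ι} (hT : T.IsAcyclic)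
    {x y z : ι} {D : Finset ι} (hD : LeavesOnlyAt T x D) (hy : y ∈ D) (hz : z ∈ D) (hyz : y ≠ z)
    (hxy : T.Adj x y) (hxz : T.Adj x z) :
    ∃ D₁ D₂ : Finset ι, D₁ ⊂ D ∧ D₂ ⊂ D ∧ LeavesOnlyAt T x D₁ ∧ LeavesOnlyAt T x D₂ ∧
      ∀ d ∈ D, d ∈ D₁ ∨ d ∈ D₂ := by
  classical
  have hbr : ¬ (T.deleteEdges {s(x, y)}).Reachable x y :=
    SimpleGraph.isBridge_iff.1 (SimpleGraph.isAcyclic_iff_forall_isBridge.1 hT hxy)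
  set R : ι → Prop := fun d => (T.deleteEdges {s(x, y)}).Reachable y d with hR
  have hxR : ¬ R x := fun h => hbr h.symm
  have hzR : ¬ R z := by
    intro h
    refine hxR (h.trans (SimpleGraph.Adj.reachable ?_))
    rw [SimpleGraph.deleteEdges_adj]
    refine ⟨hxz.symm, ?_⟩
    simp only [Set.mem_singleton_iff, Sym2.eq_iff]
    rintro (⟨h1, h2⟩ | ⟨h1, h2⟩)
    · exact hxy.ne h2
    · exact hyz h1.symm
  have hstep : ∀ d e, T.Adj d e → d ≠ x → e ≠ x → (R d ↔ R e) := by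
    intro d e hde hd he
    have hadj : (T.deleteEdges {s(x, y)}).Adj d e := by
      rw [SimpleGraph.deleteEdges_adj]
      refine ⟨hde, ?_⟩
      simp only [Set.mem_singleton_iff, Sym2.eq_iff]
      tauto
    exact ⟨fun h => h.trans hadj.reachable, fun h => h.trans hadj.symm.reachable⟩
  refine ⟨D.filter fun d => d = x ∨ R d, D.filter fun d => ¬ R d, ?_, ?_, ⟨?_, ?_⟩, ⟨?_, ?_⟩, ?_⟩
  · rw [Finset.filter_ssubset]
    exact ⟨z, hz, by simp [hxz.ne', hzR]⟩
  · rw [Finset.filter_ssubset]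
    exact ⟨y, hy, by simp [hR]⟩
  · simp [hD.1]
  · intro d hd e he hde
    by_contra hdx
    simp only [Finset.mem_filter] at hd he
    have heD : e ∈ D := by
      by_contra heD
      exact hdx (hD.2 d hd.1 e heD hde)
    have := hstep d e hde hdx
    tauto
  · simp [hD.1, hxR]
  · intro d hd e he hde
    by_contra hdx
    simp only [Finset.mem_filter] at hd he
    have heD : e ∈ D := by
      by_contra heD
      exact hdx (hD.2 d hd.1 e heD hde)
    have := hstep d e hde hdx
    have hex : e ≠ x := by
      rintro rfl
      exact he ⟨heD, hxR⟩
    tauto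
  · intro d hd
    by_cases h : R d
    · exact Or.inl (by simp [hd, h])
    · exact Or.inr (by simp [hd, h])

lemma exists_leavesOnlyAt_behindCard [Fintype ι] [Nonempty ι] {T : SimpleGraph ι}
    (hT : T.IsAcyclic) {b : ι → Finset V} {S : Finset V} {k : ℕ} (hk : 1 ≤ k)
    (hb : ∀ x, (b x).card ≤ k) (hS : 4 * k ≤ S.card) (hcov : ∀ v ∈ S, ∃ x, v ∈ b x) :
    ∃ x D, LeavesOnlyAt T x D ∧ 4 * k ≤ behindCard b S x D ∧ behindCard b S x D ≤ 8 * k := by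
  classical
  let P : ℕ → Prop := fun n => ∃ (x : ι) (D : Finset ι), D.card = n ∧ LeavesOnlyAt T x D ∧
    4 * k ≤ behindCard b S x D
  have hex : ∃ n, P n := by
    obtain ⟨x⟩ := ‹Nonempty ι›
    refine ⟨_, x, Finset.univ, rfl, ⟨Finset.mem_univ _, fun d _ e he => by simp at he⟩, ?_⟩
    have hsub : S ⊆ ((S ∩ Finset.univ.biUnion b) \ b x) ∪ b x := by
      intro v hv
      obtain ⟨y, hy⟩ := hcov v hv
      by_cases hx : v ∈ b x
      · simp [hx]
      · simp only [Finset.mem_union, Finset.mem_sdiff, Finset.mem_inter, Finset.mem_biUnion]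
        exact Or.inl ⟨⟨hv, y, Finset.mem_univ _, hy⟩, hx⟩
    have h1 := Finset.card_le_card hsub
    have h2 := Finset.card_union_le ((S ∩ Finset.univ.biUnion b) \ b x) (b x)
    unfold behindCard
    omega
  obtain ⟨x, D, hDc, hD, hge⟩ := Nat.find_spec hex
  have hmin : ∀ y D', D' ⊂ D → LeavesOnlyAt T y D' → behindCard b S y D' < 4 * k := by
    intro y D' hlt hD'
    by_contra hcon
    have := Finset.card_lt_card hlt
    exact Nat.find_min hex (m := D'.card) (by omega) ⟨y, D', rfl, hD', by omega⟩
  refine ⟨x, D, hD, hge, ?_⟩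
  by_cases htwo : ∃ y ∈ D, ∃ z ∈ D, y ≠ z ∧ T.Adj x y ∧ T.Adj x z
  · obtain ⟨y, hy, z, hz, hyz, hxy, hxz⟩ := htwo
    obtain ⟨D₁, D₂, h1, h2, h3, h4, h5⟩ := hD.exists_split hT hy hz hyz hxy hxz
    have := hmin x D₁ h1 h3
    have := hmin x D₂ h2 h4
    have := behindCard_le_add (b := b) (S := S) (x := x) h5
    omega
  · have hlt : D.erase x ⊂ D := Finset.erase_ssubset hD.1
    have key : ∃ y ∈ D.erase x, ∀ z ∈ D, T.Adj x z → z = y := by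
      by_cases hone : ∃ y ∈ D, T.Adj x y
      · obtain ⟨y, hy, hxy⟩ := hone
        refine ⟨y, Finset.mem_erase.2 ⟨hxy.ne', hy⟩, fun z hz hxz => ?_⟩
        by_contra hne
        exact htwo ⟨z, hz, y, hy, hne, hxz, hxy⟩
      · have hne : (D.erase x).Nonempty := by
          rw [Finset.nonempty_iff_ne_empty]
          intro he
          have h0 : (S ∩ D.biUnion b) \ b x = ∅ := by
            have : D = {x} := by
              rw [← Finset.insert_erase hD.1, he]; rfl
            subst this
            ext v; simp
          have := hb x
          unfold behindCard at hge
          rw [h0, Finset.card_empty] at hge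
          omega
        obtain ⟨y, hy⟩ := hne
        exact ⟨y, hy, fun z hz hxz => (hone ⟨z, hz, hxz⟩).elim⟩
    obtain ⟨y, hy, hyu⟩ := key
    have hL : LeavesOnlyAt T y (D.erase x) := by
      refine ⟨hy, fun d hd e he hde => ?_⟩
      rw [Finset.mem_erase] at hd he
      by_cases hex : e = x
      · subst hex
        exact hyu d hd.2 hde.symm
      · exact (hd.1 (hD.2 d hd.2 e (fun h => he ⟨hex, h⟩) hde)).elim
    have := hmin y _ hlt hL
    have := behindCard_le_erase (b := b) (S := S) (x := x) (y := y) (D := D)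
    have := hb x
    omega

/-- A balanced separation of `G[U]` with respect to `S`, from a tree-decomposition of `G`. -/
lemma IsTreeDecomp.exists_separation [Fintype V] [Fintype ι] {G : SimpleGraph V} {T : SimpleGraph ι}
    {B : ι → Set V} (hB : IsTreeDecomp G T B) {k : ℕ} (hk : 1 ≤ k)
    (hcard : ∀ x, (B x).ncard ≤ k) {U S : Finset V} (hSU : S ⊆ U) (hS : 4 * k ≤ S.card) :
    ∃ A C : Finset V, A ⊆ U ∧ C ⊆ U ∧ Disjoint A C ∧ C.card ≤ k ∧
      (∀ v ∈ A, ∀ w ∈ U, G.Adj v w → w ∈ A ∨ w ∈ C) ∧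
      4 * k ≤ (S ∩ A).card + C.card ∧ (S ∩ A).card + C.card ≤ 8 * k := by
  classical
  let b : ι → Finset V := fun x => (B x).toFinset ∩ U
  have hbk : ∀ x, (b x).card ≤ k := fun x =>
    (Finset.card_le_card Finset.inter_subset_left).trans
      (by rw [← Set.ncard_eq_toFinset_card']; exact hcard x)
  have hmem : ∀ v ∈ U, ∀ x, v ∈ b x ↔ v ∈ B x := fun v hv x => by simp [b, hv]
  have hcov : ∀ v ∈ U, ∃ x, v ∈ b x := fun v hv => by
    obtain ⟨x⟩ := (hB.subtree v).nonempty
    exact ⟨x.1, (hmem v hv _).2 x.2⟩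
  have hconn : ∀ v ∈ U, (T.induce {y | v ∈ b y}).Connected := fun v hv => by
    have h : {y | v ∈ b y} = {y | v ∈ B y} := Set.ext (hmem v hv)
    rw [h]
    exact hB.subtree v
  have : Nonempty ι := hB.isTree.connected.nonempty
  obtain ⟨x, D, hD, h1, h2⟩ := exists_leavesOnlyAt_behindCard (T := T) hB.isTree.isAcyclic hk hbk
    hS (fun v hv => hcov v (hSU hv))
  have hSA : S ∩ (D.biUnion b \ b x) = (S ∩ D.biUnion b) \ b x := by
    ext v; simp; tauto
  refine ⟨D.biUnion b \ b x, b x, ?_, Finset.inter_subset_right, Finset.sdiff_disjoint, hbk x, ?_,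
    by rw [hSA]; exact h1, by rw [hSA]; exact h2⟩
  · refine Finset.sdiff_subset.trans (Finset.biUnion_subset.2 fun d _ => Finset.inter_subset_right)
  · intro v hv w hw hvw
    simp only [Finset.mem_sdiff, Finset.mem_biUnion] at hv ⊢
    obtain ⟨⟨d, hd, hvd⟩, hvx⟩ := hv
    have hvU : v ∈ U := (Finset.mem_inter.1 hvd).2
    obtain ⟨e, hve, hwe⟩ := hB.edge_mem hvw
    rw [← hmem v hvU] at hve
    rw [← hmem w hw] at hwe
    by_cases he : e ∈ D
    · by_cases hwx : w ∈ b x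
      · exact Or.inr hwx
      · exact Or.inl ⟨⟨e, he, hwe⟩, hwx⟩
    · exact (hvx (mem_bag_of_leavesOnlyAt hD (hconn v hvU) hd he hvd hve)).elim

end Separator

section RootedPartition

variable {V : Type*} {α β : Type}

/-- The graph on `Option α` with root `none` in which `some a` is joined to its parent `par a`. -/
def parentGraph (par : α → Option α) : SimpleGraph (Option α) :=
  SimpleGraph.fromRel fun x y => ∃ a, x = some a ∧ y = par a

/-- The children of a node. -/
def children (par : α → Option α) (x : Option α) : Set α := {a | par a = x}

open scoped Classical in
/-- The part of `U` assigned to the node `x`. -/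
noncomputable def part (U : Finset V) (f : V → Option α) (x : Option α) : Finset V :=
  U.filter fun v => f v = x

lemma mem_part {U : Finset V} {f : V → Option α} {x : Option α} {v : V} :
    v ∈ part U f x ↔ v ∈ U ∧ f v = x := by
  simp [part]

/-- The function `f` is a tree-partition of `G[U]` over the rooted tree given by `par`. -/
structure IsRootedPartition (G : SimpleGraph V) (U : Finset V) (par : α → Option α)
    (f : V → Option α) : Prop where
  /-- parents have smaller rank -/
  exists_rank : ∃ rk : α → ℕ, ∀ a b, par a = some b → rk b < rk a
  /-- the parts are nonempty -/
  part_nonempty : ∀ x, ∃ v ∈ U, f v = x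
  /-- adjacent vertices lie in equal or adjacent parts -/
  part_adj : ∀ v ∈ U, ∀ w ∈ U, G.Adj v w → f v = f w ∨ (parentGraph par).Adj (f v) (f w)

lemma parentGraph_adj_parent {par : α → Option α} {rk : α → ℕ}
    (h : ∀ a b, par a = some b → rk b < rk a) (a : α) :
    (parentGraph par).Adj (some a) (par a) := by
  rw [parentGraph, SimpleGraph.fromRel_adj]
  refine ⟨fun h' => ?_, Or.inl ⟨a, rfl, rfl⟩⟩
  exact lt_irrefl _ (h a a h'.symm)

lemma isTree_parentGraph [Finite α] {par : α → Option α} {rk : α → ℕ}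
    (h : ∀ a b, par a = some b → rk b < rk a) : (parentGraph par).IsTree := by
  have hreach : ∀ n a, rk a < n → (parentGraph par).Reachable (some a) none := by
    intro n
    induction n with
    | zero => intro a ha; omega
    | succ n ih =>
      intro a ha
      refine (parentGraph_adj_parent h a).reachable.trans ?_
      match hp : par a with
      | none => exact .refl _
      | some b =>
        have := h a b hp
        exact ih b (by omega)
  have hroot : ∀ x, (parentGraph par).Reachable x none
    | none => .refl _
    | some a => hreach _ a (Nat.lt_succ_self _)
  have hconn : (parentGraph par).Connected :=
    { preconnected := fun x y => (hroot x).trans (hroot y).symm }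
  refine SimpleGraph.isTree_iff_connected_and_card.2 ⟨hconn, ?_⟩
  have h1 := hconn.card_vert_le_card_edgeSet_add_one
  have h2 : (parentGraph par).edgeSet ⊆ Set.range fun a => s(some a, par a) := by
    intro e
    induction e with
    | _ x y =>
      rw [SimpleGraph.mem_edgeSet, parentGraph, SimpleGraph.fromRel_adj]
      rintro ⟨-, ⟨a, rfl, rfl⟩ | ⟨a, rfl, rfl⟩⟩
      · exact ⟨a, rfl⟩
      · exact ⟨a, Sym2.eq_swap⟩
  have h3 := Set.ncard_le_ncard h2 (Set.toFinite _)
  have h4 : (Set.range fun a => s(some a, par a)).ncard ≤ Nat.card α := by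
    rw [← Set.image_univ, ← Set.ncard_univ]
    exact Set.ncard_image_le
  rw [← Nat.card_coe_set_eq] at h3
  rw [Finite.card_option] at h1 ⊢
  omega

lemma ncard_neighborSet_parentGraph_none_le [Finite α] (par : α → Option α) :
    ((parentGraph par).neighborSet none).ncard ≤ (children par none).ncard := by
  have h : (parentGraph par).neighborSet none ⊆ some '' children par none := by
    intro y hy
    rw [SimpleGraph.mem_neighborSet, parentGraph, SimpleGraph.fromRel_adj] at hy
    obtain ⟨-, ⟨a, h1, -⟩ | ⟨a, rfl, h2⟩⟩ := hy
    · cases h1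
    · exact ⟨a, h2.symm, rfl⟩
  exact (Set.ncard_le_ncard h (Set.toFinite _)).trans Set.ncard_image_le

lemma ncard_neighborSet_parentGraph_some_le [Finite α] (par : α → Option α) (a : α) :
    ((parentGraph par).neighborSet (some a)).ncard ≤ (children par (some a)).ncard + 1 := by
  have h : (parentGraph par).neighborSet (some a) ⊆
      insert (par a) (some '' children par (some a)) := by
    intro y hy
    rw [SimpleGraph.mem_neighborSet, parentGraph, SimpleGraph.fromRel_adj] at hy
    obtain ⟨-, ⟨b, h1, rfl⟩ | ⟨b, rfl, h2⟩⟩ := hy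
    · cases h1
      exact Or.inl rfl
    · exact Or.inr ⟨b, h2.symm, rfl⟩
  refine (Set.ncard_le_ncard h (Set.toFinite _)).trans ((Set.ncard_insert_le _ _).trans ?_)
  exact Nat.add_le_add_right Set.ncard_image_le _

lemma parentGraph_adj_map {par : α → Option α} {par' : β → Option β} {g : Option α → Option β}
    (hg : g.Injective) (h : ∀ a, ∃ b, g (some a) = some b ∧ par' b = g (par a)) {x y : Option α}
    (hxy : (parentGraph par).Adj x y) : (parentGraph par').Adj (g x) (g y) := by
  rw [parentGraph, SimpleGraph.fromRel_adj] at hxy ⊢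
  refine ⟨fun he => hxy.1 (hg he), ?_⟩
  obtain ⟨-, ⟨a, rfl, rfl⟩ | ⟨a, rfl, rfl⟩⟩ := hxy
  · obtain ⟨b, h1, h2⟩ := h a
    exact Or.inl ⟨b, h1, h2.symm⟩
  · obtain ⟨b, h1, h2⟩ := h a
    exact Or.inr ⟨b, h1, h2.symm⟩

lemma IsRootedPartition.isTreePartition [Fintype V] [Finite α] {G : SimpleGraph V}
    {par : α → Option α} {f : V → Option α} (h : IsRootedPartition G Finset.univ par f) :
    IsTreePartition G (parentGraph par) fun x => {v | f v = x} where
  isTree := by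
    obtain ⟨rk, hrk⟩ := h.exists_rank
    exact isTree_parentGraph hrk
  part_nonempty x := by
    obtain ⟨v, -, hv⟩ := h.part_nonempty x
    exact ⟨v, hv⟩
  part_existsUnique v := ⟨f v, rfl, fun y hy => Eq.symm hy⟩
  part_adj := by
    rintro v w x y hvw rfl rfl
    exact h.part_adj v (Finset.mem_univ _) w (Finset.mem_univ _) hvw

/-- The tree-partition with only one part. -/
lemma isRootedPartition_empty (G : SimpleGraph V) {U : Finset V} (hU : U.Nonempty) :
    IsRootedPartition G U (Empty.elim : Empty → Option Empty) fun _ => none where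
  exists_rank := ⟨fun _ => 0, fun a => a.elim⟩
  part_nonempty
    | none => by
      obtain ⟨v, hv⟩ := hU
      exact ⟨v, hv, rfl⟩
    | some a => a.elim
  part_adj _ _ _ _ _ := Or.inl rfl

open scoped Classical in
/-- The tree-partition with two parts `S` and `U \ S`. -/
lemma isRootedPartition_unit (G : SimpleGraph V) {U S : Finset V} (hS : S.Nonempty) (hSU : S ⊂ U) :
    IsRootedPartition G U (fun _ : Unit => none) fun v => if v ∈ S then none else some () where
  exists_rank := ⟨fun _ => 0, fun a b h => by simp at h⟩
  part_nonempty
    | none => by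
      obtain ⟨v, hv⟩ := hS
      exact ⟨v, hSU.1 hv, by simp [hv]⟩
    | some () => by
      obtain ⟨v, hv, hvS⟩ := Finset.exists_of_ssubset hSU
      exact ⟨v, hv, by simp [hvS]⟩
  part_adj v _ w _ _ := by
    by_cases hv : v ∈ S <;> by_cases hw : w ∈ S <;>
      simp [hv, hw, parentGraph, SimpleGraph.fromRel_adj]

/-- The parent function after adding a new root above the old one. -/
def newRootParent (par : α → Option α) : Option α → Option (Option α)
  | none => none
  | some a => some (par a)

open scoped Classical in
/-- Adding a new root whose part is `S`. -/
lemma IsRootedPartition.newRoot {G : SimpleGraph V} {U S : Finset V} {par : α → Option α}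
    {f : V → Option α} (h : IsRootedPartition G (U \ S) par f) (hS : S.Nonempty) (hSU : S ⊆ U)
    (hf : ∀ v ∈ S, ∀ w ∈ U \ S, G.Adj v w → f w = none) :
    IsRootedPartition G U (newRootParent par) fun v => if v ∈ S then none else some (f v) where
  exists_rank := by
    obtain ⟨rk, hrk⟩ := h.exists_rank
    refine ⟨fun x => x.elim 0 fun a => rk a + 1, ?_⟩
    rintro (_ | a) (_ | b) hab
    · simp [newRootParent] at hab
    · simp [newRootParent] at hab
    · simp
    · simp only [newRootParent, Option.some.injEq] at hab
      simpa using hrk a b hab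
  part_nonempty
    | none => by
      obtain ⟨v, hv⟩ := hS
      exact ⟨v, hSU hv, by simp [hv]⟩
    | some x => by
      obtain ⟨v, hv, rfl⟩ := h.part_nonempty x
      rw [Finset.mem_sdiff] at hv
      exact ⟨v, hv.1, by simp [hv.2]⟩
  part_adj v hv w hw hvw := by
    by_cases hvS : v ∈ S <;> by_cases hwS : w ∈ S
    · simp [hvS, hwS]
    · have := hf v hvS w (by simp [hw, hwS]) hvw
      refine Or.inr ?_
      rw [parentGraph, SimpleGraph.fromRel_adj]
      simp only [hvS, hwS, this, if_true, if_false]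
      exact ⟨by simp, Or.inr ⟨none, rfl, rfl⟩⟩
    · have := hf w hwS v (by simp [hv, hvS]) hvw.symm
      refine Or.inr ?_
      rw [parentGraph, SimpleGraph.fromRel_adj]
      simp only [hvS, hwS, this, if_true, if_false]
      exact ⟨by simp, Or.inl ⟨none, rfl, rfl⟩⟩
    · simp only [hvS, hwS, if_false]
      rcases h.part_adj v (by simp [hv, hvS]) w (by simp [hw, hwS]) hvw with h' | h'
      · exact Or.inl (congrArg some h')
      · exact Or.inr (parentGraph_adj_map (par' := newRootParent par) (Option.some_injective _)
          (fun a => ⟨_, rfl, rfl⟩) h')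

lemma children_newRootParent_none (par : α → Option α) :
    children (newRootParent par) none = {none} := by
  ext (_ | a) <;> simp [children, newRootParent]

lemma children_newRootParent_some (par : α → Option α) (x : Option α) :
    children (newRootParent par) (some x) = some '' children par x := by
  ext (_ | a) <;> simp [children, newRootParent]

/-- The parent function after identifying the roots of two trees. -/
def mergeParent (par₁ : α → Option α) (par₂ : β → Option β) : α ⊕ β → Option (α ⊕ β) :=
  Sum.elim (fun a => (par₁ a).map Sum.inl) fun b => (par₂ b).map Sum.inr

open scoped Classical in
/-- The assignment of nodes after identifying the roots of two trees. -/
noncomputable def mergeMap (U₁ : Finset V) (f₁ : V → Option α) (f₂ : V → Option β) (v : V) :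
    Option (α ⊕ β) :=
  if v ∈ U₁ then (f₁ v).map Sum.inl else (f₂ v).map Sum.inr

lemma mergeMap_of_mem_left {U₁ : Finset V} {f₁ : V → Option α} {f₂ : V → Option β} {v : V}
    (hv : v ∈ U₁) : mergeMap U₁ f₁ f₂ v = (f₁ v).map Sum.inl := by
  simp [mergeMap, hv]

lemma mergeMap_of_mem_right {U₁ U₂ : Finset V} {f₁ : V → Option α} {f₂ : V → Option β}
    (h₁ : ∀ v ∈ U₁, v ∈ U₂ → f₁ v = none) (h₂ : ∀ v ∈ U₁, v ∈ U₂ → f₂ v = none) {v : V}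
    (hv : v ∈ U₂) : mergeMap U₁ f₁ f₂ v = (f₂ v).map Sum.inr := by
  by_cases hv₁ : v ∈ U₁
  · simp [mergeMap, hv₁, h₁ v hv₁ hv, h₂ v hv₁ hv]
  · simp [mergeMap, hv₁]

open scoped Classical in
/-- Merging two tree-partitions along their roots. -/
lemma IsRootedPartition.merge {G : SimpleGraph V} {U₁ U₂ : Finset V}
    {par₁ : α → Option α} {par₂ : β → Option β} {f₁ : V → Option α} {f₂ : V → Option β}
    (H₁ : IsRootedPartition G U₁ par₁ f₁) (H₂ : IsRootedPartition G U₂ par₂ f₂)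
    (h₁ : ∀ v ∈ U₁, v ∈ U₂ → f₁ v = none) (h₂ : ∀ v ∈ U₁, v ∈ U₂ → f₂ v = none)
    (hsep : ∀ v ∈ U₁, v ∉ U₂ → ∀ w ∈ U₂, G.Adj v w → w ∈ U₁) :
    IsRootedPartition G (U₁ ∪ U₂) (mergeParent par₁ par₂) (mergeMap U₁ f₁ f₂) where
  exists_rank := by
    obtain ⟨rk₁, hrk₁⟩ := H₁.exists_rank
    obtain ⟨rk₂, hrk₂⟩ := H₂.exists_rank
    refine ⟨Sum.elim rk₁ rk₂, ?_⟩
    rintro (a | a) (b | b) hab <;> simp [mergeParent] at hab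
    · exact hrk₁ a b hab
    · exact hrk₂ a b hab
  part_nonempty
    | none => by
      obtain ⟨v, hv, hv'⟩ := H₁.part_nonempty none
      exact ⟨v, by simp [hv], by rw [mergeMap_of_mem_left hv, hv']; rfl⟩
    | some (.inl a) => by
      obtain ⟨v, hv, hv'⟩ := H₁.part_nonempty (some a)
      exact ⟨v, by simp [hv], by rw [mergeMap_of_mem_left hv, hv']; rfl⟩
    | some (.inr b) => by
      obtain ⟨v, hv, hv'⟩ := H₂.part_nonempty (some b)
      exact ⟨v, by simp [hv], by rw [mergeMap_of_mem_right h₁ h₂ hv, hv']; rfl⟩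
  part_adj v hv w hw hvw := by
    have hcase : (v ∈ U₁ ∧ w ∈ U₁) ∨ (v ∈ U₂ ∧ w ∈ U₂) := by
      rw [Finset.mem_union] at hv hw
      have := hsep v
      have := hsep w
      have := hvw.symm
      tauto
    rcases hcase with ⟨hv, hw⟩ | ⟨hv, hw⟩
    · rw [mergeMap_of_mem_left hv, mergeMap_of_mem_left hw]
      rcases H₁.part_adj v hv w hw hvw with h | h
      · exact Or.inl (by rw [h])
      · exact Or.inr (parentGraph_adj_map (Option.map_injective Sum.inl_injective)
          (fun a => ⟨_, rfl, rfl⟩) h)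
    · rw [mergeMap_of_mem_right h₁ h₂ hv, mergeMap_of_mem_right h₁ h₂ hw]
      rcases H₂.part_adj v hv w hw hvw with h | h
      · exact Or.inl (by rw [h])
      · exact Or.inr (parentGraph_adj_map (Option.map_injective Sum.inr_injective)
          (fun a => ⟨_, rfl, rfl⟩) h)

lemma children_mergeParent_none (par₁ : α → Option α) (par₂ : β → Option β) :
    children (mergeParent par₁ par₂) none =
      Sum.inl '' children par₁ none ∪ Sum.inr '' children par₂ none := by
  ext (a | a) <;> simp [children, mergeParent]

lemma children_mergeParent_inl (par₁ : α → Option α) (par₂ : β → Option β) (a : α) :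
    children (mergeParent par₁ par₂) (some (.inl a)) = Sum.inl '' children par₁ (some a) := by
  ext (b | b) <;> simp [children, mergeParent]

lemma children_mergeParent_inr (par₁ : α → Option α) (par₂ : β → Option β) (b : β) :
    children (mergeParent par₁ par₂) (some (.inr b)) = Sum.inr '' children par₂ (some b) := by
  ext (a | a) <;> simp [children, mergeParent]

end RootedPartition

section Main

variable {V : Type*} {α β : Type}

/-- A rooted tree-partition of `G[U]` with `S` in its root part, with the bounds that make the
induction on `U` work. -/
structure IsBoundedPartition (G : SimpleGraph V) (k d : ℕ) (U S : Finset V) (par : α → Option α)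
    (f : V → Option α) : Prop extends IsRootedPartition G U par f where
  /-- `S` is contained in the root part -/
  eq_none : ∀ v ∈ S, f v = none
  /-- the root part is not much larger than `S` -/
  card_root : 2 * (part U f none).card + 4 * k ≤ 3 * S.card
  /-- the width is bounded -/
  card_part : ∀ x, (part U f x).card ≤ 18 * k * d
  /-- the degree of the root is bounded in terms of `S` -/
  ncard_children_root : 2 * k * ((children par none).ncard + 1) ≤ S.card
  /-- the degrees of the other nodes are bounded -/
  ncard_children : ∀ a, (children par (some a)).ncard + 1 ≤ 6 * d

open scoped Classical in
lemma exists_isBoundedPartition_of_card_sdiff_le (G : SimpleGraph V) {k d : ℕ} (hk : 1 ≤ k)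
    (hd : 1 ≤ d) {U S : Finset V} (hSU : S ⊆ U) (hS : 4 * k ≤ S.card)
    (hS' : S.card ≤ 12 * k * d) (h : (U \ S).card ≤ 18 * k * d) :
    ∃ (α : Type) (_ : Finite α) (par : α → Option α) (f : V → Option α),
      IsBoundedPartition G k d U S par f := by
  have hne : S.Nonempty := Finset.card_pos.1 (by omega)
  have hkd : 12 * k * d ≤ 18 * k * d := by gcongr; norm_num
  rcases hSU.eq_or_ssubset with rfl | hlt
  · have hpart : (part S (fun _ => (none : Option Empty)) none).card ≤ S.card :=
      Finset.card_le_card fun v hv => (mem_part.1 hv).1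
    have hch : children (Empty.elim : Empty → Option Empty) none = ∅ :=
      Set.eq_empty_of_isEmpty _
    refine ⟨Empty, inferInstance, _, _, isRootedPartition_empty G hne, fun _ _ => rfl, by omega,
      ?_, ?_, fun a => a.elim⟩
    · rintro (_ | a)
      · omega
      · exact a.elim
    · rw [hch, Set.ncard_empty]; omega
  · have hpart : part U (fun v => if v ∈ S then none else some ()) none ⊆ S := by
      intro v hv
      by_contra hvS
      simp [mem_part, hvS] at hv
    have hpart' : part U (fun v => if v ∈ S then none else some ()) (some ()) ⊆ U \ S := by
      intro v hv
      rw [mem_part] at hv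
      refine Finset.mem_sdiff.2 ⟨hv.1, fun hvS => ?_⟩
      simp [hvS] at hv
    have h1 := Finset.card_le_card hpart
    have h2 := Finset.card_le_card hpart'
    refine ⟨Unit, inferInstance, _, _, isRootedPartition_unit G hne hlt, fun v hv => by simp [hv],
      by omega, ?_, ?_, ?_⟩
    · rintro (_ | ⟨⟩)
      · omega
      · exact h2.trans h
    · have h3 : (children (fun _ : Unit => none) none).ncard ≤ 1 := by
        simpa using Set.ncard_le_card (children (fun _ : Unit => none) none)
      calc _ ≤ 2 * k * (1 + 1) := by gcongr
        _ ≤ _ := by omega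
    · intro a
      have : children (fun _ : Unit => none) (some a) = ∅ := by ext; simp [children]
      rw [this, Set.ncard_empty]; omega

open scoped Classical in
lemma IsBoundedPartition.newRoot [Finite α] {G : SimpleGraph V} {k d : ℕ} (hk : 1 ≤ k)
    {U S S' : Finset V} {par : α → Option α} {f : V → Option α}
    (h : IsBoundedPartition G k d (U \ S) S' par f) (hSU : S ⊆ U) (hS : 4 * k ≤ S.card)
    (hS' : S.card ≤ 12 * k * d) (hS'' : S'.card ≤ 12 * k * d)
    (hnb : ∀ v ∈ S, ∀ w ∈ U \ S, G.Adj v w → w ∈ S') :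
    ∃ (α : Type) (_ : Finite α) (par : α → Option α) (f : V → Option α),
      IsBoundedPartition G k d U S par f := by
  have hne : S.Nonempty := Finset.card_pos.1 (by omega)
  have hkd : 12 * k * d ≤ 18 * k * d := by gcongr; norm_num
  have hpart : (part U (fun v => if v ∈ S then none else some (f v)) none).card ≤ S.card := by
    refine Finset.card_le_card fun v hv => ?_
    by_contra hvS
    simp [mem_part, hvS] at hv
  refine ⟨Option α, inferInstance, _, _,
    h.toIsRootedPartition.newRoot hne hSU fun v hv w hw hvw => h.eq_none w (hnb v hv w hw hvw),
    fun v hv => by simp [hv], by omega, ?_, ?_, ?_⟩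
  · rintro (_ | x)
    · omega
    · refine (Finset.card_le_card fun v hv => ?_).trans (h.card_part x)
      rw [mem_part] at hv ⊢
      by_cases hvS : v ∈ S
      · simp [hvS] at hv
      · simpa [hvS] using hv
  · rw [children_newRootParent_none, Set.ncard_singleton]; omega
  · intro x
    rw [children_newRootParent_some, Set.ncard_image_of_injective _ (Option.some_injective _)]
    cases x with
    | none =>
      have h1 := h.ncard_children_root.trans hS''
      have h2 : 2 * k * ((children par none).ncard + 1) ≤ 2 * k * (6 * d) :=
        h1.trans (le_of_eq (by ring))
      exact Nat.le_of_mul_le_mul_left h2 (by omega)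
    | some a => exact h.ncard_children a

open scoped Classical in
lemma IsBoundedPartition.merge [Finite α] [Finite β] {G : SimpleGraph V} {k d : ℕ}
    {U₁ U₂ S S₁ S₂ : Finset V} {par₁ : α → Option α} {par₂ : β → Option β} {f₁ : V → Option α}
    {f₂ : V → Option β} (H₁ : IsBoundedPartition G k d U₁ S₁ par₁ f₁)
    (H₂ : IsBoundedPartition G k d U₂ S₂ par₂ f₂)
    (h₁ : U₁ ∩ U₂ ⊆ S₁) (h₂ : U₁ ∩ U₂ ⊆ S₂) (hS₁ : ∀ v ∈ S, v ∈ U₁ → v ∈ S₁)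
    (hS₂ : ∀ v ∈ S, v ∈ U₂ → v ∈ S₂) (hSU : S ⊆ U₁ ∪ U₂)
    (hsep : ∀ v ∈ U₁, v ∉ U₂ → ∀ w ∈ U₂, G.Adj v w → w ∈ U₁) (hc : (U₁ ∩ U₂).card ≤ k)
    (hcard : S₁.card + S₂.card ≤ S.card + 2 * (U₁ ∩ U₂).card) (hS : S.card ≤ 12 * k * d) :
    IsBoundedPartition G k d (U₁ ∪ U₂) S (mergeParent par₁ par₂) (mergeMap U₁ f₁ f₂) := by
  have e₁ : ∀ v ∈ U₁, v ∈ U₂ → f₁ v = none := fun v hv hv' =>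
    H₁.eq_none v (h₁ (Finset.mem_inter.2 ⟨hv, hv'⟩))
  have e₂ : ∀ v ∈ U₁, v ∈ U₂ → f₂ v = none := fun v hv hv' =>
    H₂.eq_none v (h₂ (Finset.mem_inter.2 ⟨hv, hv'⟩))
  have hroot : 2 * (part (U₁ ∪ U₂) (mergeMap U₁ f₁ f₂) none).card + 4 * k ≤ 3 * S.card := by
    have hsub : part (U₁ ∪ U₂) (mergeMap U₁ f₁ f₂) none ⊆ part U₁ f₁ none ∪ part U₂ f₂ none := by
      intro v hv
      rw [mem_part, Finset.mem_union] at hv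
      rw [Finset.mem_union, mem_part, mem_part]
      by_cases hv₁ : v ∈ U₁
      · rw [mergeMap_of_mem_left hv₁, Option.map_eq_none_iff] at hv
        exact Or.inl ⟨hv₁, hv.2⟩
      · have hv₂ := hv.1.resolve_left hv₁
        rw [mergeMap_of_mem_right e₁ e₂ hv₂, Option.map_eq_none_iff] at hv
        exact Or.inr ⟨hv₂, hv.2⟩
    have hint : U₁ ∩ U₂ ⊆ part U₁ f₁ none ∩ part U₂ f₂ none := by
      intro v hv
      rw [Finset.mem_inter] at hv
      rw [Finset.mem_inter, mem_part, mem_part]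
      exact ⟨⟨hv.1, e₁ v hv.1 hv.2⟩, hv.2, e₂ v hv.1 hv.2⟩
    have i1 := Finset.card_le_card hsub
    have i2 := Finset.card_le_card hint
    have i3 := Finset.card_union_add_card_inter (part U₁ f₁ none) (part U₂ f₂ none)
    have i4 := H₁.card_root
    have i5 := H₂.card_root
    omega
  refine ⟨H₁.toIsRootedPartition.merge H₂.toIsRootedPartition e₁ e₂ hsep, ?_, hroot, ?_, ?_, ?_⟩
  · intro v hv
    rcases Finset.mem_union.1 (hSU hv) with h | h
    · rw [mergeMap_of_mem_left h, H₁.eq_none v (hS₁ v hv h)]; rfl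
    · rw [mergeMap_of_mem_right e₁ e₂ h, H₂.eq_none v (hS₂ v hv h)]; rfl
  · rintro (_ | (a | b))
    · have : 2 * (18 * k * d) = 3 * (12 * k * d) := by ring
      omega
    · refine (Finset.card_le_card fun v hv => ?_).trans (H₁.card_part (some a))
      rw [mem_part, Finset.mem_union] at hv
      by_cases hv₁ : v ∈ U₁
      · rw [mergeMap_of_mem_left hv₁] at hv
        exact mem_part.2 ⟨hv₁, by simpa using hv.2⟩
      · simp [mergeMap, hv₁] at hv
    · refine (Finset.card_le_card fun v hv => ?_).trans (H₂.card_part (some b))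
      rw [mem_part, Finset.mem_union] at hv
      by_cases hv₁ : v ∈ U₁
      · simp [mergeMap, hv₁] at hv
      · have hv₂ := hv.1.resolve_left hv₁
        rw [mergeMap_of_mem_right e₁ e₂ hv₂] at hv
        exact mem_part.2 ⟨hv₂, by simpa using hv.2⟩
  · have i1 := Set.ncard_union_le (Sum.inl '' children par₁ none) (Sum.inr '' children par₂ none)
    rw [← children_mergeParent_none, Set.ncard_image_of_injective _ Sum.inl_injective,
      Set.ncard_image_of_injective _ Sum.inr_injective] at i1
    have i2 := H₁.ncard_children_root
    have i3 := H₂.ncard_children_root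
    have i4 : 2 * k * ((children (mergeParent par₁ par₂) none).ncard + 1) + 2 * k ≤
        2 * k * ((children par₁ none).ncard + 1) + 2 * k * ((children par₂ none).ncard + 1) :=
      calc _ ≤ 2 * k * ((children par₁ none).ncard + (children par₂ none).ncard + 1) + 2 * k := by
            gcongr
        _ = _ := by ring
    omega
  · rintro (a | b)
    · rw [children_mergeParent_inl, Set.ncard_image_of_injective _ Sum.inl_injective]
      exact H₁.ncard_children a
    · rw [children_mergeParent_inr, Set.ncard_image_of_injective _ Sum.inr_injective]
      exact H₂.ncard_children b

open scoped Classical in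
lemma IsTreeDecomp.exists_isBoundedPartition [Fintype V] {ι : Type*} [Fintype ι]
    {G : SimpleGraph V} {T : SimpleGraph ι} {B : ι → Set V} (hB : IsTreeDecomp G T B) {k d : ℕ}
    (hk : 1 ≤ k) (hd : 1 ≤ d) (hcard : ∀ x, (B x).ncard ≤ k)
    (hdeg : ∀ v, (G.neighborSet v).ncard ≤ d) (U S : Finset V) (hSU : S ⊆ U)
    (hS : 4 * k ≤ S.card) (hS' : S.card ≤ 12 * k * d) :
    ∃ (α : Type) (_ : Finite α) (par : α → Option α) (f : V → Option α),
      IsBoundedPartition G k d U S par f := by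
  induction U using Finset.strongInduction generalizing S with
  | H U ih =>
  by_cases hsmall : (U \ S).card ≤ 18 * k * d
  · exact exists_isBoundedPartition_of_card_sdiff_le G hk hd hSU hS hS' hsmall
  have hkd : 12 * k ≤ 12 * k * d := Nat.le_mul_of_pos_right _ hd
  have hkd' : 12 * k * d ≤ 18 * k * d := by gcongr; norm_num
  by_cases hlow : S.card ≤ 12 * k
  · set N : Finset V := S.biUnion (fun v => (G.neighborSet v).toFinset) ∩ (U \ S) with hN
    have hNcard : N.card ≤ 12 * k * d := by
      refine (Finset.card_le_card Finset.inter_subset_left).trans ?_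
      refine (Finset.card_biUnion_le_card_mul S _ d fun v _ => ?_).trans (by gcongr)
      rw [← Set.ncard_eq_toFinset_card']
      exact hdeg v
    obtain ⟨S', hNS', hS'U, hS'card⟩ := Finset.exists_subsuperset_card_eq (s := N) (t := U \ S)
      (n := max N.card (4 * k)) Finset.inter_subset_right (le_max_left _ _) (by omega)
    have hlt : U \ S ⊂ U := Finset.sdiff_ssubset hSU (Finset.card_pos.1 (by omega))
    obtain ⟨α, _, par, f, h⟩ := ih (U \ S) hlt S' hS'U (by omega) (by omega)
    refine h.newRoot hk hSU hS hS' (by omega) fun v hv w hw hvw => hNS' ?_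
    simp only [hN, Finset.mem_inter, Finset.mem_biUnion, Set.mem_toFinset,
      SimpleGraph.mem_neighborSet]
    exact ⟨⟨v, hv, hvw⟩, hw⟩
  · obtain ⟨A, C, hAU, hCU, hAC, hC, hsep, hlo, hhi⟩ := hB.exists_separation hk hcard hSU hS
    have hdisj : ∀ v ∈ A, v ∉ C := fun v hv hv' => Finset.disjoint_left.1 hAC hv hv'
    have hinter : (A ∪ C) ∩ (U \ A) = C := by
      ext v
      have := hdisj v
      have := @hCU v
      simp only [Finset.mem_inter, Finset.mem_union, Finset.mem_sdiff]
      tauto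
    have hunion : (A ∪ C) ∪ (U \ A) = U := by
      ext v
      have := @hAU v
      have := @hCU v
      simp only [Finset.mem_union, Finset.mem_sdiff]
      tauto
    have hcardSA := Finset.card_sdiff_add_card_inter S A
    have hc₁' : ((S ∩ A) ∪ C).card = (S ∩ A).card + C.card :=
      Finset.card_union_of_disjoint (hAC.mono_left Finset.inter_subset_right)
    have hc₂ : ((S \ A) ∪ C).card ≤ (S \ A).card + C.card := Finset.card_union_le _ _
    have hc₂' : (S \ A).card ≤ ((S \ A) ∪ C).card := Finset.card_le_card Finset.subset_union_left
    have hU₁ : A ∪ C ⊂ U := by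
      refine (Finset.union_subset hAU hCU).ssubset_of_ne fun he => ?_
      have : S \ A ⊆ C := fun v hv => by
        rw [Finset.mem_sdiff] at hv
        have := hSU hv.1
        rw [← he, Finset.mem_union] at this
        exact this.resolve_left hv.2
      have := Finset.card_le_card this
      omega
    have hU₂ : U \ A ⊂ U := by
      refine Finset.sdiff_ssubset hAU (Finset.card_pos.1 ?_)
      have : (S ∩ A).card ≤ A.card := Finset.card_le_card Finset.inter_subset_right
      omega
    obtain ⟨α, _, par₁, f₁, H₁⟩ := ih _ hU₁ ((S ∩ A) ∪ C)
      (Finset.union_subset_union_left Finset.inter_subset_right) (by omega) (by omega)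
    obtain ⟨β, _, par₂, f₂, H₂⟩ := ih _ hU₂ ((S \ A) ∪ C)
      (Finset.union_subset (Finset.sdiff_subset_sdiff hSU le_rfl) fun v hv =>
        Finset.mem_sdiff.2 ⟨hCU hv, fun h => hdisj v h hv⟩) (by omega) (by omega)
    have H := H₁.merge (S := S) H₂ (by rw [hinter]; exact Finset.subset_union_right)
      (by rw [hinter]; exact Finset.subset_union_right)
      (fun v hv hv' => by
        simp only [Finset.mem_union, Finset.mem_inter] at hv' ⊢; tauto)
      (fun v hv hv' => by
        simp only [Finset.mem_union, Finset.mem_sdiff] at hv' ⊢; tauto)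
      (by rw [hunion]; exact hSU)
      (fun v hv hv' w hw hvw => by
        have hvA : v ∈ A := by
          by_contra hvA
          exact hv' (Finset.mem_sdiff.2
            ⟨hCU ((Finset.mem_union.1 hv).resolve_left hvA), hvA⟩)
        exact Finset.mem_union.2 (hsep v hvA w (Finset.mem_sdiff.1 hw).1 hvw))
      (by rw [hinter]; exact hC) (by rw [hinter]; omega) hS'
    rw [hunion] at H
    exact ⟨_, inferInstance, _, _, H⟩

/-- The treewidth is attained by some tree-decomposition. -/
lemma exists_isTreeDecomp_treewidth {V : Type} [Fintype V] (G : SimpleGraph V) :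
    ∃ (ι : Type) (_ : Fintype ι) (T : SimpleGraph ι) (B : ι → Set V),
      IsTreeDecomp G T B ∧ ∀ x, (B x).ncard ≤ treewidth G + 1 := by
  refine Nat.sInf_mem (s := {k | ∃ (ι : Type) (_ : Fintype ι) (T : SimpleGraph ι) (B : ι → Set V),
    IsTreeDecomp G T B ∧ ∀ x, (B x).ncard ≤ k + 1}) ⟨Fintype.card V, Unit, inferInstance, ⊥,
      fun _ => Set.univ, ⟨.of_subsingleton, fun u v _ => ⟨(), trivial, trivial⟩, fun v => ?_⟩,
      fun x => ?_⟩
  · have : Nonempty {x : Unit | v ∈ (Set.univ : Set V)} := ⟨⟨(), trivial⟩⟩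
    exact ⟨SimpleGraph.Preconnected.of_subsingleton⟩
  · rw [Set.ncard_univ, Nat.card_eq_fintype_card]; omega

lemma ncard_neighborSet_le_maxDeg [Fintype V] (G : SimpleGraph V) (v : V) :
    (G.neighborSet v).ncard ≤ maxDeg G :=
  le_csSup (Set.finite_range _).bddAbove ⟨v, rfl⟩

end Main

/-- Every non-trivial graph `G` has a `T`-partition of width at most
`18·(tw(G)+1)·Δ(G)` for some tree `T` with `Δ(T) ≤ 6·Δ(G)`. -/
theorem exists_treePartition_of_nontrivial {V : Type} [Fintype V] (G : SimpleGraph V)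
    (hG : G.edgeSet.Nonempty) :
    ∃ (ι : Type) (_ : Fintype ι) (T : SimpleGraph ι) (B : ι → Set V),
      IsTreePartition G T B ∧
      (∀ x, (B x).ncard ≤ 18 * (treewidth G + 1) * maxDeg G) ∧
      (∀ x, (T.neighborSet x).ncard ≤ 6 * maxDeg G) := by
  obtain ⟨v, w, hvw⟩ : ∃ v w, G.Adj v w := by
    obtain ⟨e, he⟩ := hG
    induction e with
    | _ v w => exact ⟨v, w, he⟩
  have hd : 1 ≤ maxDeg G :=
    ((Set.ncard_pos (Set.toFinite _)).2 ⟨w, hvw⟩).trans_le (ncard_neighborSet_le_maxDeg G v)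
  obtain ⟨ι, _, T, B, hB, hcard⟩ := exists_isTreeDecomp_treewidth G
  set k := treewidth G + 1 with hk
  set d := maxDeg G
  have hkd : 4 * k ≤ 12 * k * d :=
    (Nat.mul_le_mul_right k (by norm_num)).trans (Nat.le_mul_of_pos_right (12 * k) hd)
  have hkd' : 12 * k * d ≤ 18 * k * d := by gcongr; norm_num
  have hncard : ∀ {α : Type} (f : V → Option α) (x : Option α),
      {v | f v = x}.ncard = (part Finset.univ f x).card := fun f x => by
    rw [← Set.ncard_coe_finset]
    congr 1
    ext v
    simp [mem_part]
  by_cases hV : 4 * k ≤ (Finset.univ : Finset V).card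
  · obtain ⟨S, hSU, hS⟩ := Finset.exists_subset_card_eq hV
    obtain ⟨α, _, par, f, h⟩ := hB.exists_isBoundedPartition (by omega) hd hcard
      (ncard_neighborSet_le_maxDeg G) Finset.univ S hSU hS.ge (hS.le.trans hkd)
    refine ⟨Option α, Fintype.ofFinite _, _, _, h.toIsRootedPartition.isTreePartition, fun x => ?_,
      ?_⟩
    · rw [hncard]
      exact h.card_part x
    · rintro (_ | a)
      · refine (ncard_neighborSet_parentGraph_none_le par).trans ?_
        have h1 := h.ncard_children_root
        have h2 : 2 * k * ((children par none).ncard + 1) ≤ 2 * k * 2 := by omega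
        have := Nat.le_of_mul_le_mul_left h2 (by omega)
        omega
      · exact (ncard_neighborSet_parentGraph_some_le par a).trans (h.ncard_children a)
  · refine ⟨Option Empty, inferInstance, _, _,
      (isRootedPartition_empty G ⟨v, Finset.mem_univ v⟩).isTreePartition, fun x => ?_, fun x => ?_⟩
    · rw [hncard]
      have := Finset.card_le_univ (part Finset.univ (fun _ : V => (none : Option Empty)) x)
      rw [← Finset.card_univ] at this
      omega
    · refine (Set.ncard_le_card _).trans ?_
      simp only [Nat.card_eq_fintype_card, Fintype.card_option, Fintype.card_empty]
      omega
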